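/- arXiv:1309.4741 — 5 statements merged into one kernel-verified Lean document; each statement's English description precedes it below -/
import Mathlib

section
/- For all positive integers n, s, h with 1 ≤ s ≤ n−2 and h ≤ n−1, there exists an s-overlap cycle on the set of all strings of length n over the alphabet {1, 2, …, h} with ground set {1, 2, …, h} (that is, strings in which every letter of {1, …, h} appears at least once; equivalently, surjective functions from {1,…,n} onto {1,…,h}). -/
/-- `L` is an `s`-overlap cycle on the set `C` of strings of length `n`:
a cyclic ordering (a list, read cyclically) in which every element of `C`
appears exactly once and the length-`s` suffix of each string equals the
length-`s` prefix of the (cyclically) next string. -/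
def IsOvCycle (n s : ℕ) {α : Type*} (C : Set (List α)) (L : List (List α)) : Prop :=
  L.Nodup ∧ (∀ x, x ∈ L ↔ x ∈ C) ∧
    ∀ i : Fin L.length,
      (L.get i).drop (n - s) =
        (L.get ⟨((i : ℕ) + 1) % L.length, Nat.mod_lt _ i.pos⟩).take s

/-- Composing with a transposition merges two cycles of a permutation. -/
theorem Equiv.Perm.sameCycle_mul_swap {α : Type*} [Finite α] [DecidableEq α]
    (τ : Equiv.Perm α) {x z : α} (hxz : ¬ τ.SameCycle x z) :
    (τ * Equiv.swap x z).SameCycle x z ∧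
      ∀ y, τ.SameCycle x y → (τ * Equiv.swap x z).SameCycle x y := by
  set τ' := τ * Equiv.swap x z with hτ'
  have hx : τ' x = τ z := by simp [hτ']
  have hz : τ' z = τ x := by simp [hτ']
  have hne : ∀ w, w ≠ x → w ≠ z → τ' w = τ w := fun w h₁ h₂ => by
    simp [hτ', Equiv.swap_apply_of_ne_of_ne h₁ h₂]
  have key : ∀ k : ℕ, τ'.SameCycle x ((τ ^ (k + 1)) z) := by
    intro k
    induction k with
    | zero =>
      rw [zero_add, pow_one, ← hx]
      exact (Equiv.Perm.sameCycle_apply_right).2 (Equiv.Perm.SameCycle.refl _ _)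
    | succ k ih =>
      rw [pow_succ', Equiv.Perm.mul_apply]
      by_cases h : (τ ^ (k + 1)) z = z
      · rw [h, ← hx]
        exact (Equiv.Perm.sameCycle_apply_right).2 (Equiv.Perm.SameCycle.refl _ _)
      · rw [← hne _ _ h]
        · exact (Equiv.Perm.sameCycle_apply_right).2 ih
        · intro h'
          exact hxz (Equiv.Perm.SameCycle.symm ⟨(k + 1 : ℕ), by rw [zpow_natCast]; exact h'⟩)
  have hxz' : τ'.SameCycle x z := by
    have := key (orderOf τ - 1)
    rwa [Nat.sub_add_cancel (orderOf_pos τ), pow_orderOf_eq_one, Equiv.Perm.one_apply] at this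
  refine ⟨hxz', fun y hy => ?_⟩
  obtain ⟨k, rfl⟩ := hy.exists_nat_pow_eq
  induction k with
  | zero => exact Equiv.Perm.SameCycle.refl _ _
  | succ k ih =>
    have hk : τ.SameCycle x ((τ ^ k) x) := ⟨k, by rw [zpow_natCast]⟩
    rw [pow_succ', Equiv.Perm.mul_apply]
    by_cases h : (τ ^ k) x = x
    · rw [h, ← hz]
      exact (Equiv.Perm.sameCycle_apply_right).2 hxz'
    · rw [← hne _ h]
      · exact (Equiv.Perm.sameCycle_apply_right).2 (ih hk)
      · intro h'
        rw [h'] at hk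
        exact hxz hk

/-- An Euler circuit theorem: `α` is the set of edges of a finite directed multigraph with
source map `p` and target map `q`; balancedness is witnessed by `σ`. -/
theorem exists_perm_forall_sameCycle {α β : Type*} [Finite α] (p q : α → β)
    (σ : Equiv.Perm α) (hσ : ∀ x, p (σ x) = q x)
    (hconn : ∀ S : Set α, S.Nonempty → (∀ x ∈ S, ∀ y, p y = q x → y ∈ S) → S = Set.univ)
    (x₀ : α) :
    ∃ τ : Equiv.Perm α, (∀ x, p (τ x) = q x) ∧ ∀ y, τ.SameCycle x₀ y := by
  classical
  obtain ⟨τ, hτ, hmax⟩ := Set.exists_max_image {τ : Equiv.Perm α | ∀ x, p (τ x) = q x}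
    (fun τ => {y | τ.SameCycle x₀ y}.ncard) (Set.toFinite _) ⟨σ, hσ⟩
  refine ⟨τ, hτ, ?_⟩
  suffices h : {y | τ.SameCycle x₀ y} = Set.univ from fun y => by
    have : y ∈ {y | τ.SameCycle x₀ y} := h ▸ Set.mem_univ y
    exact this
  refine hconn _ ⟨x₀, Equiv.Perm.SameCycle.refl _ _⟩ fun x hx y hxy => ?_
  by_contra hy
  simp only [Set.mem_ofPred_eq] at hx hy
  have hz : ¬ τ.SameCycle x₀ (τ⁻¹ y) := fun h =>
    hy (by simpa using (Equiv.Perm.sameCycle_apply_right (f := τ)).2 h)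
  have hq : q (τ⁻¹ y) = q x := by rw [← hτ, ← hxy]; simp
  obtain ⟨h₁, h₂⟩ := τ.sameCycle_mul_swap (x := x) (z := τ⁻¹ y) fun h => hz (hx.trans h)
  have hx₀ := (h₂ x₀ hx.symm).symm
  refine absurd (hmax (τ * Equiv.swap x (τ⁻¹ y)) fun w => ?_) (not_le.2 ?_)
  · rw [Equiv.Perm.mul_apply, hτ]
    by_cases hw : w = x
    · rw [hw, Equiv.swap_apply_left, hq]
    by_cases hw' : w = τ⁻¹ y
    · rw [hw', Equiv.swap_apply_right, hq]
    rw [Equiv.swap_apply_of_ne_of_ne hw hw']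
  · refine Set.ncard_lt_ncard ⟨fun w hw => hx₀.trans (h₂ w (hx.symm.trans hw)), fun h => ?_⟩
      (Set.toFinite _)
    exact hz (h (hx₀.trans h₁))

/-- If the domain is larger than the codomain, any two surjections are connected by
changing one value at a time, through surjections. -/
theorem Function.Surjective.mem_of_update_closed {ι κ : Type*} [Fintype ι] [Fintype κ]
    [DecidableEq ι] [DecidableEq κ] (hcard : Fintype.card κ < Fintype.card ι) (S : Set (ι → κ))
    (hsurj : ∀ f ∈ S, Function.Surjective f)
    (hS : ∀ f ∈ S, ∀ i a, Function.Surjective (Function.update f i a) →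
      Function.update f i a ∈ S)
    {f g : ι → κ} (hf : f ∈ S) (hg : Function.Surjective g) : g ∈ S := by
  have hdup : ∀ f ∈ S, ∀ i j a, i ≠ j → f i = f j → Function.update f i a ∈ S := by
    intro f hf i j a hij hfij
    refine hS f hf i a fun b => ?_
    obtain ⟨k, hk⟩ := hsurj f hf b
    by_cases hki : k = i
    · exact ⟨j, by rw [Function.update_of_ne hij.symm, ← hfij, ← hki, hk]⟩
    · exact ⟨k, by rw [Function.update_of_ne hki, hk]⟩
  induction hm : hammingDist f g using Nat.strong_induction_on generalizing f with
  | _ m ih =>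
  by_cases hfg : f = g
  · exact hfg ▸ hf
  by_cases hcase : ∃ i j, i ≠ j ∧ f i = f j ∧ f i ≠ g i
  · obtain ⟨i, j, hij, hfij, hi⟩ := hcase
    refine ih _ ?_ (hdup f hf i j (g i) hij hfij) rfl
    rw [← hm]
    refine Finset.card_lt_card ⟨fun k hk => ?_, fun h => ?_⟩
    · by_cases hki : k = i
      · simp [hki] at hk
      · simpa [Function.update_of_ne hki] using hk
    · simpa using h (show i ∈ _ by simpa using hi)
  push Not at hcase
  obtain ⟨i, j, hij, hfij⟩ := Fintype.exists_ne_map_eq_of_card_lt f hcard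
  obtain ⟨p, hp⟩ := Function.ne_iff.1 hfg
  obtain ⟨r, hr⟩ := hg (f p)
  have hi := hcase i j hij hfij
  have hpu : ∀ k, k ≠ p → f k ≠ f p := fun k hk h => hp (hcase p k hk.symm h.symm)
  have hrp : r ≠ p := fun h => hp (by rw [← hr, h])
  have hrg : f r ≠ g r := hr ▸ hpu r hrp
  have hip : i ≠ p := fun h => hp (h ▸ hi)
  have hir : i ≠ r := fun h => hrg (h ▸ hi)
  have h₁ := hdup f hf i j (f r) hij hfij
  have h₂ := hdup _ h₁ r i (f p) hir.symm (by simp [hir.symm])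
  have h₃ := hdup _ h₂ p r (g p) hrp.symm (by simp [hrp.symm, hip.symm])
  refine ih _ ?_ h₃ rfl
  rw [← hm]
  set D : Finset ι := {k | f k ≠ g k} with hD
  have hpD : p ∈ D := by simpa [hD] using hp
  have hrD : r ∈ D.erase p := by simpa [hD, hrp] using hrg
  have hle : hammingDist (Function.update (Function.update (Function.update f i (f r)) r (f p))
      p (g p)) g ≤ (insert i ((D.erase p).erase r)).card := by
    refine Finset.card_le_card fun k hk => ?_
    simp only [Finset.mem_filter, Finset.mem_univ, true_and] at hk
    simp only [Finset.mem_insert, Finset.mem_erase, hD, Finset.mem_filter, Finset.mem_univ,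
      true_and]
    by_cases hkp : k = p
    · simp [hkp] at hk
    by_cases hkr : k = r
    · simp [hkr, hrp, hr] at hk
    by_cases hki : k = i
    · exact Or.inl hki
    · simp only [ne_eq, hkp, not_false_eq_true, Function.update_of_ne, hkr, hki] at hk
      exact Or.inr ⟨hkr, hkp, hk⟩
  have h₄ := Finset.card_insert_le i ((D.erase p).erase r)
  have h₅ := Finset.card_erase_add_one hrD
  have h₆ := Finset.card_erase_add_one hpD
  change _ < D.card
  omega

/-- Cyclic rotation by `d` as a permutation of the surjections `Fin n → κ`. -/
def rotateSurj {n : ℕ} [NeZero n] (κ : Type*) (d : Fin n) :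
    Equiv.Perm {f : Fin n → κ // Function.Surjective f} where
  toFun f := ⟨fun i => f.1 (i + d), f.2.comp (Equiv.addRight d).surjective⟩
  invFun f := ⟨fun i => f.1 (i - d), f.2.comp (Equiv.subRight d).surjective⟩
  left_inv f := by simp
  right_inv f := by simp

/-- The overlap graph on surjections `Fin n → κ` is strongly connected. -/
theorem surj_overlap_connected {n s : ℕ} {κ : Type*} [Fintype κ] (hs : 1 ≤ s)
    (hsn : s < n) (hcard : Fintype.card κ < n)
    (S : Set {f : Fin n → κ // Function.Surjective f}) (hne : S.Nonempty)
    (hS : ∀ f ∈ S, ∀ g : {f : Fin n → κ // Function.Surjective f},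
      (∀ k (hk : k < s), g.1 ⟨k, by omega⟩ = f.1 ⟨k + (n - s), by omega⟩) → g ∈ S) :
    S = Set.univ := by
  classical
  have : NeZero n := ⟨by omega⟩
  set d : Fin n := ⟨n - s, by omega⟩ with hd
  have hadd : ∀ k (hk : k < s), (⟨k, by omega⟩ + d : Fin n) = ⟨k + (n - s), by omega⟩ := by
    intro k hk
    apply Fin.ext
    rw [Fin.val_add, hd]
    exact Nat.mod_eq_of_lt (by simp only; omega)
  have hrot : ∀ f ∈ S, rotateSurj κ d f ∈ S := fun f hf =>
    hS f hf _ fun k hk => congrArg f.1 (hadd k hk)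
  have hrot' : ∀ f, rotateSurj κ d f ∈ S → f ∈ S := fun f hf => by
    simpa using Equiv.Perm.perm_symm_mapsTo_of_mapsTo (rotateSurj κ d) (s := S) hrot hf
  have hchange : ∀ m (hm : m < n), ∀ f ∈ S, ∀ g : {f : Fin n → κ // Function.Surjective f},
      (∀ k, k ≠ ⟨m, hm⟩ → g.1 k = f.1 k) → g ∈ S := by
    intro m
    induction m using Nat.strong_induction_on with
    | _ m ih =>
    intro hm f hf g hfg
    apply hrot'
    by_cases hmd : m < n - s
    · refine hS f hf _ fun k hk => ?_
      rw [← hadd k hk]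
      refine hfg _ fun h => ?_
      rw [hadd k hk, Fin.mk.injEq] at h
      omega
    · refine ih (m - (n - s)) (by omega) (by omega) _ (hrot f hf) _ fun k hk => hfg _ fun h => hk ?_
      have h' := hadd (m - (n - s)) (by omega)
      rw [← add_left_inj d, h, h', Fin.mk.injEq]
      omega
  obtain ⟨f, hf⟩ := hne
  refine Set.eq_univ_of_forall fun g => ?_
  have := Function.Surjective.mem_of_update_closed (by simpa using hcard) (Subtype.val '' S)
    (by rintro _ ⟨f, -, rfl⟩; exact f.2)
    (by
      rintro _ ⟨f, hf, rfl⟩ i a h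
      exact ⟨⟨_, h⟩, hchange i i.2 f hf _ fun k hk => Function.update_of_ne hk _ _, rfl⟩)
    ⟨f, hf, rfl⟩ g.2
  obtain ⟨g', hg', h⟩ := this
  exact Subtype.ext h ▸ hg'

/-- for positive `n, s, h` with `1 ≤ s ≤ n-2` and `h ≤ n-1`, there is an
`s`-overlap cycle on the strings of length `n` with ground set `{1,…,h}`, i.e. strings
whose letters all lie in `{1,…,h}` and in which every letter of `{1,…,h}` occurs. -/
theorem stmt_3 (n s h : ℕ) (hn : 0 < n) (hs1 : 1 ≤ s) (hh : 0 < h)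
    (hsn : s ≤ n - 2) (hhn : h ≤ n - 1) :
    ∃ L, IsOvCycle n s
      {l : List ℕ | l.length = n ∧ (∀ x ∈ l, 1 ≤ x ∧ x ≤ h) ∧
        ∀ x : ℕ, 1 ≤ x → x ≤ h → x ∈ l} L := by
  have : NeZero n := ⟨by omega⟩
  have : NeZero h := ⟨by omega⟩
  let word : {f : Fin n → Fin h // Function.Surjective f} → List ℕ :=
    fun f => List.ofFn fun i => (f.1 i : ℕ) + 1
  have hword : Function.Injective word := by
    intro f g hfg
    ext i
    have := congrFun (List.ofFn_injective hfg) i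
    omega
  let p : {f : Fin n → Fin h // Function.Surjective f} → Fin s → Fin h :=
    fun f k => f.1 ⟨k, by omega⟩
  let q : {f : Fin n → Fin h // Function.Surjective f} → Fin s → Fin h :=
    fun f k => f.1 ⟨k + (n - s), by omega⟩
  let f₀ : {f : Fin n → Fin h // Function.Surjective f} :=
    ⟨fun i => Fin.ofNat h i, fun b => ⟨⟨b, by omega⟩, by simp⟩⟩
  obtain ⟨τ, hτ, hcyc⟩ := exists_perm_forall_sameCycle p q
    (rotateSurj (Fin h) ⟨n - s, by omega⟩)
    (fun f => funext fun k => congrArg f.1 (Fin.ext (by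
      rw [Fin.val_add]
      exact Nat.mod_eq_of_lt (by simp only; omega))))
    (fun S hS hcl => surj_overlap_connected (s := s) hs1 (by omega) (by simp; omega) S hS
      fun f hf g hfg => hcl f hf g (funext fun k => hfg k k.2)) f₀
  have hpq : ∀ f g, p g = q f → (word f).drop (n - s) = (word g).take s := by
    intro f g hfg
    apply List.ext_getElem
    · simp [word]; omega
    · intro k h₁ h₂
      have hk : k < s := by simp at h₂; omega
      have := congrFun hfg ⟨k, hk⟩
      simp only [p, q] at this
      simp [word, this, add_comm]
  have hper : f₀ ∈ Function.periodicPts τ := τ.injective.mem_periodicPts f₀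
  set N := Function.minimalPeriod τ f₀
  refine ⟨(List.range N).map fun k => word (τ^[k] f₀), ?_, ?_, ?_⟩
  · have h := (Function.nodup_periodicOrbit (f := τ) (x := f₀))
    rw [Function.periodicOrbit, Cycle.nodup_coe_iff] at h
    have := h.map hword
    rwa [List.map_map] at this
  · intro l
    have hmem : ∀ f, ∃ k < N, τ^[k] f₀ = f := by
      intro f
      have : f ∈ Function.periodicOrbit τ f₀ := by
        rw [Function.mem_periodicOrbit_iff hper]
        obtain ⟨k, hk⟩ := (hcyc f).exists_nat_pow_eq
        exact ⟨k, by rw [← hk, Equiv.Perm.coe_pow]⟩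
      simpa [Function.periodicOrbit, eq_comm] using this
    simp only [List.mem_map, List.mem_range, Set.mem_ofPred_eq]
    constructor
    · rintro ⟨k, -, rfl⟩
      refine ⟨by simp [word], fun x hx => ?_, fun x h₁ h₂ => ?_⟩
      · obtain ⟨i, rfl⟩ := (List.mem_ofFn' _ _).1 hx
        simp only
        omega
      · obtain ⟨i, hi⟩ := (τ^[k] f₀).2 ⟨x - 1, by omega⟩
        refine (List.mem_ofFn' _ _).2 ⟨i, ?_⟩
        simp only [hi]
        omega
    · rintro ⟨hl, h₁, h₂⟩
      have hr : ∀ i : Fin n, 1 ≤ l[i] ∧ l[i] ≤ h := fun i => h₁ _ (List.getElem_mem _)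
      let f : {f : Fin n → Fin h // Function.Surjective f} :=
        ⟨fun i => ⟨l[i] - 1, by have := hr i; omega⟩, fun b => by
          obtain ⟨i, hi, hb⟩ := List.getElem_of_mem (h₂ (b + 1) (by omega) (by omega))
          exact ⟨⟨i, by omega⟩, Fin.ext (by simp [hb])⟩⟩
      obtain ⟨k, hk, hkf⟩ := hmem f
      refine ⟨k, hk, ?_⟩
      rw [hkf]
      apply List.ext_getElem
      · simp [word, hl]
      · intro i hi hi'
        have := hr ⟨i, by omega⟩
        simp only [Fin.getElem_fin] at this
        simp only [word, f, List.getElem_ofFn, Fin.getElem_fin]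
        omega
  · intro i
    simp only [List.get_eq_getElem, List.getElem_map, List.getElem_range, List.length_map,
      List.length_range]
    have hmod : τ^[((i : ℕ) + 1) % N] f₀ = τ^[(i : ℕ) + 1] f₀ :=
      Function.iterate_mod_minimalPeriod_eq
    rw [hmod]
    apply hpq
    rw [Function.iterate_succ_apply', hτ]
end

section
/- Let T = t_0 t_1 … t_{n−1} be a juggling sequence of period n and suppose t_i ≥ n for some index i. Then the string T' obtained from T by replacing t_i with t_i − n (and leaving all other entries unchanged) is also a valid juggling sequence of period n, and the number of balls of T' is one less than the number of balls of T. More generally, replacing any entry t_j by t_j + n also yields a valid juggling sequence. -/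
/-- A string `t : Fin n → ℕ` is a juggling sequence of period `n` when the map
`i ↦ (i + t i) mod n` is a bijection of `{0,…,n-1}`. -/
def IsJuggling {n : ℕ} (t : Fin n → ℕ) : Prop :=
  Function.Bijective
    (fun i : Fin n => (⟨((i : ℕ) + t i) % n, Nat.mod_lt _ i.pos⟩ : Fin n))

/-- Changing one entry within its residue class modulo `n` preserves being a juggling sequence. -/
theorem IsJuggling.update_of_modEq {n : ℕ} {t : Fin n → ℕ} (ht : IsJuggling t) (i : Fin n)
    {a : ℕ} (ha : a ≡ t i [MOD n]) : IsJuggling (Function.update t i a) := by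
  unfold IsJuggling at ht ⊢
  convert ht using 3 with j
  rcases eq_or_ne j i with rfl | hj
  · rw [Function.update_self]
    exact ha.add_left _
  · rw [Function.update_of_ne hj]

/-- if `T` is a juggling sequence of period `n` and `t_i ≥ n`, then
replacing `t_i` by `t_i - n` yields a valid juggling sequence whose number of balls
`(Σ t'_j)/n` is one less than that of `T`; and, more generally, replacing any entry
`t_j` by `t_j + n` also yields a valid juggling sequence. -/
theorem stmt_7 (n : ℕ) (hn : 0 < n) (t : Fin n → ℕ) (ht : IsJuggling t)
    (i : Fin n) (hi : n ≤ t i) :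
    IsJuggling (Function.update t i (t i - n)) ∧
      (∑ j, Function.update t i (t i - n) j) / n = (∑ j, t j) / n - 1 ∧
      ∀ j : Fin n, IsJuggling (Function.update t j (t j + n)) := by
  refine ⟨ht.update_of_modEq i ?_, ?_, fun j => ht.update_of_modEq j (by simp [Nat.ModEq])⟩
  · exact (Nat.mod_eq_sub_mod hi).symm
  · have hsum : ∑ j, t j = (∑ j, Function.update t i (t i - n) j) + n := by
      rw [Finset.sum_update_of_mem (Finset.mem_univ i),
        ← Finset.add_sum_erase _ t (Finset.mem_univ i), Finset.sdiff_singleton_eq_erase]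
      omega
    rw [hsum, Nat.add_div_right _ hn, Nat.add_sub_cancel]
end

section
/- If T = t_0 t_1 … t_{n−1} is a juggling sequence of period n, then n divides Σ_{i=0}^{n−1} t_i; that is, the number of balls b = (1/n) Σ_{i=0}^{n−1} t_i is a nonnegative integer. -/
/-- if `T` is a juggling sequence of period `n`, then `n` divides
`Σ_{i=0}^{n-1} t_i`, i.e. the number of balls is a (nonnegative) integer. -/
theorem stmt_8 (n : ℕ) (t : Fin n → ℕ) (ht : IsJuggling t) :
    n ∣ ∑ i, t i := by
  have hsum : ∑ i : Fin n, ((i : ℕ) + t i) % n = ∑ i : Fin n, (i : ℕ) :=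
    ht.sum_comp (fun i : Fin n => (i : ℕ))
  have hmod : ∑ i : Fin n, ((i : ℕ) + t i) ≡ ∑ i : Fin n, (i : ℕ) [MOD n] := by
    rw [Nat.ModEq, Finset.sum_nat_mod, hsum]
  rw [Finset.sum_add_distrib] at hmod
  exact (Nat.modEq_zero_iff_dvd).1 (Nat.ModEq.add_left_cancel' _ hmod)
end

section
/- Let n be a positive integer and let d be a positive divisor of n with d < n. Define the string T = t_0 t_1 … t_{n−1} by t_0 = d, t_d = n − d, and t_i = 0 for all other indices i. Then T is a valid juggling sequence of period n using exactly one ball, and its permutation sequence Π_T is the transposition of {0,…,n−1} swapping 0 and d (i.e. Π_T(0) = d, Π_T(d) = 0, and Π_T(i) = i otherwise). In particular, the sum of the first d entries of T equals d, which is not congruent to 0 modulo n. -/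
/-- The permutation sequence `Π_T` of `T`: `Π_T(i) = (t_i + i) mod n`. -/
def piSeq {n : ℕ} (t : Fin n → ℕ) : Fin n → ℕ :=
  fun i => (t i + (i : ℕ)) % n

/-- The string `T` with `t_0 = d`, `t_d = n - d`, and `t_i = 0` otherwise. -/
def tseq (n d : ℕ) : ℕ → ℕ :=
  fun i => if i = 0 then d else if i = d then n - d else 0

theorem tseq_add_mod {n d i : ℕ} (hdn : d < n) (hi : i < n) :
    (tseq n d i + i) % n = if i = 0 then d else if i = d then 0 else i := by
  unfold tseq
  split_ifs with h0 hid
  · rw [h0, add_zero, Nat.mod_eq_of_lt hdn]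
  · rw [hid, Nat.sub_add_cancel hdn.le, Nat.mod_self]
  · rw [zero_add, Nat.mod_eq_of_lt hi]

theorem sum_range_tseq {n d m : ℕ} (hd : 0 < d) (hm : 0 < m) :
    ∑ i ∈ Finset.range m, tseq n d i = d + if d < m then n - d else 0 := by
  have h (i : ℕ) : tseq n d i = (if 0 = i then d else 0) + if d = i then n - d else 0 := by
    unfold tseq
    split_ifs <;> omega
  simp only [h, Finset.sum_add_distrib, Finset.sum_ite_eq, Finset.mem_range, if_pos hm]

/-- for `0 < d < n` a divisor of `n`, the string with `t_0 = d`,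
`t_d = n - d` and all other entries `0` is a valid juggling sequence of period `n`
with exactly one ball (its entries sum to `1·n`), its permutation sequence is the
transposition of `{0,…,n-1}` swapping `0` and `d`, and the sum of its first `d`
entries is `d`, which is not congruent to `0` modulo `n`. -/
theorem stmt_9 (n d : ℕ) (hn : 0 < n) (hd : 0 < d) (hdvd : d ∣ n) (hdn : d < n) :
    IsJuggling (fun i : Fin n => tseq n d (i : ℕ)) ∧
      (∑ i : Fin n, tseq n d (i : ℕ)) = 1 * n ∧
      (∀ i : Fin n, piSeq (fun j : Fin n => tseq n d (j : ℕ)) i =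
        if (i : ℕ) = 0 then d else if (i : ℕ) = d then 0 else (i : ℕ)) ∧
      (∑ i ∈ Finset.range d, tseq n d i) = d ∧
      ¬ d ≡ 0 [MOD n] := by
  refine ⟨Finite.injective_iff_bijective.mp fun i j hij => ?_, ?_,
    fun i => tseq_add_mod hdn i.isLt, ?_, ?_⟩
  · have h := congrArg Fin.val hij
    simp only [add_comm _ (tseq _ _ _)] at h
    rw [tseq_add_mod hdn i.isLt, tseq_add_mod hdn j.isLt] at h
    apply Fin.ext
    split_ifs at h <;> omega
  · rw [Fin.sum_univ_eq_sum_range, sum_range_tseq hd hn, if_pos hdn]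
    omega
  · rw [sum_range_tseq hd hd, if_neg (lt_irrefl d), add_zero]
  · rw [Nat.modEq_zero_iff_dvd]
    exact Nat.not_dvd_of_pos_of_lt hd hdn
end

section
/- Let n, s be positive integers with 1 ≤ s ≤ n−1 and n − s = gcd(n,s) = d, and let M be a multiset of size n. Partition any permutation X = x_0 x_1 … x_{n−1} of M into m = n/d consecutive blocks X_0, …, X_{m−1} of length d. If X and X' are permutations of M such that some string W is simultaneously obtainable from X by a sequence of moves, each of which either rotates the string by s positions or permutes the entries within its final (n−s)-suffix, and likewise from X', then the cyclic sequence of blocks of X' (each block regarded as a multiset of size d) is a rotation of the cyclic sequence of blocks of X. In particular, a single rotation by s of X yields a string whose blocks, as multisets, are a cyclic rotation of the blocks of X. -/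
/-- The rotation `ρ^s`: the entry of `rotF s X` at position `i` is the entry of `X`
at position `(i + s) mod n`. -/
def rotF {α : Type*} {n : ℕ} (s : ℕ) (X : Fin n → α) : Fin n → α :=
  fun i => X ⟨((i : ℕ) + s) % n, Nat.mod_lt _ i.pos⟩

/-- The `a`-th `d`-block of the string `X` of length `n`, regarded as a multiset of
size `d`: the multiset of entries `x_{(ad) mod n}, x_{(ad+1) mod n}, …, x_{(ad+d-1) mod n}`
(indices taken cyclically, so `a` may be any natural number). -/
def blockMS {α : Type*} {n : ℕ} (hn : 0 < n) (d : ℕ) (X : Fin n → α) (a : ℕ) :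
    Multiset α :=
  (Multiset.range d).map (fun t => X ⟨(a * d + t) % n, Nat.mod_lt _ hn⟩)

/-- A single move on strings of length `n`: either rotate by `s` positions, or permute
the entries within the final `(n-s)`-suffix (i.e. apply a permutation of positions that
fixes the first `s` positions pointwise). -/
def Move {α : Type*} {n : ℕ} (s : ℕ) (X Y : Fin n → α) : Prop :=
  Y = rotF s X ∨
    ∃ σ : Equiv.Perm (Fin n), (∀ i : Fin n, (i : ℕ) < s → σ i = i) ∧ ∀ i, Y i = X (σ i)

theorem blockMS_congr_mod {α : Type*} {n : ℕ} (hn : 0 < n) {d m : ℕ} (hm : n = m * d)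
    (X : Fin n → α) {a b : ℕ} (hab : a % m = b % m) :
    blockMS hn d X a = blockMS hn d X b := by
  refine Multiset.map_congr rfl fun t _ => congrArg X (Fin.ext ?_)
  have h : a * d ≡ b * d [MOD n] := hm ▸ Nat.ModEq.mul_right' d hab
  exact h.add_right t

theorem blockMS_rotF {α : Type*} {n : ℕ} (hn : 0 < n) (d k : ℕ) (X : Fin n → α) (a : ℕ) :
    blockMS hn d (rotF (k * d) X) a = blockMS hn d X (a + k) := by
  refine Multiset.map_congr rfl fun t _ => congrArg X (Fin.ext ?_)
  simp only [Nat.mod_add_mod]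
  congr 1
  ring

/-- The last `d`-block consists of the entries in positions `≥ k * d`. -/
theorem blockMS_last {α : Type*} {n : ℕ} (hn : 0 < n) {d k : ℕ} (hm : n = (k + 1) * d)
    (X : Fin n → α) :
    blockMS hn d X k = (Finset.univ.filter fun i : Fin n => k * d ≤ i).val.map X := by
  have hm' : n = k * d + d := by rw [hm]; ring
  have hmod : ∀ t < d, (k * d + t) % n = k * d + t := fun t ht =>
    Nat.mod_eq_of_lt (by omega)
  have hset : (Finset.univ.filter fun i : Fin n => k * d ≤ i).val =
      (Multiset.range d).map fun t => (⟨(k * d + t) % n, Nat.mod_lt _ hn⟩ : Fin n) := by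
    refine (Multiset.Nodup.ext (Finset.nodup _) ?_).2 fun i => ?_
    · refine (Multiset.nodup_range d).map_on fun x hx y hy hxy => ?_
      rw [Multiset.mem_range] at hx hy
      simp only [Fin.mk.injEq, hmod x hx, hmod y hy] at hxy
      omega
    · simp only [Finset.mem_val, Finset.mem_filter, Finset.mem_univ, true_and,
        Multiset.mem_map, Multiset.mem_range]
      constructor
      · intro h
        have hi := i.isLt
        refine ⟨i - k * d, by omega, Fin.ext ?_⟩
        rw [Fin.val_mk, hmod _ (by omega)]
        omega
      · rintro ⟨t, ht, rfl⟩
        rw [Fin.val_mk, hmod t ht]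
        omega
  rw [hset, Multiset.map_map]
  rfl

/-- Permuting the entries of the last block does not change any block as a multiset. -/
theorem blockMS_comp_perm {α : Type*} {n : ℕ} (hn : 0 < n) {d k : ℕ}
    (hm : n = (k + 1) * d) (X : Fin n → α) (σ : Equiv.Perm (Fin n))
    (hσ : ∀ i : Fin n, (i : ℕ) < k * d → σ i = i) (a : ℕ) :
    blockMS hn d (X ∘ σ) a = blockMS hn d X a := by
  have ha : a % (k + 1) < k + 1 := Nat.mod_lt _ k.succ_pos
  rw [blockMS_congr_mod hn hm (X ∘ σ) (Nat.mod_mod a (k + 1)).symm,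
    blockMS_congr_mod hn hm X (Nat.mod_mod a (k + 1)).symm]
  generalize a % (k + 1) = b at ha
  rcases Nat.lt_succ_iff_lt_or_eq.1 ha with hb | rfl
  · refine Multiset.map_congr rfl fun t ht => congrArg X (hσ _ ?_)
    rw [Multiset.mem_range] at ht
    have h : (b + 1) * d ≤ k * d := Nat.mul_le_mul_right d hb
    rw [add_mul, one_mul] at h
    exact (Nat.mod_le _ _).trans_lt (by omega)
  · rw [blockMS_last hn hm, blockMS_last hn hm, ← Multiset.map_map]
    congr 1
    have hmem : ∀ i : Fin n, b * d ≤ (σ i : ℕ) ↔ b * d ≤ (i : ℕ) := by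
      intro i
      rw [← not_lt, ← not_lt, not_iff_not]
      refine ⟨fun h => ?_, fun h => by rwa [hσ i h]⟩
      rwa [← σ.injective (hσ (σ i) h)]
    rw [← Equiv.coe_toEmbedding, ← Finset.map_val]
    congr 1
    ext i
    rw [Finset.mem_map_equiv]
    simp [← hmem (σ.symm i)]

theorem exists_blockMS_eq_of_reflTransGen_move {α : Type*} {n : ℕ} (hn : 0 < n) {d k : ℕ}
    (hm : n = (k + 1) * d) {X W : Fin n → α}
    (h : Relation.ReflTransGen (Move (k * d)) X W) :
    ∃ r : ℕ, ∀ a : ℕ, blockMS hn d W a = blockMS hn d X (a + r) := by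
  induction h with
  | refl => exact ⟨0, fun _ => rfl⟩
  | @tail Y Z _ hYZ ih =>
    obtain ⟨r, hr⟩ := ih
    rcases hYZ with rfl | ⟨σ, hσ, hZ⟩
    · exact ⟨k + r, fun a => by rw [blockMS_rotF, hr, add_assoc]⟩
    · obtain rfl : Z = Y ∘ σ := funext hZ
      exact ⟨r, fun a => by rw [blockMS_comp_perm hn hm Y σ hσ, hr]⟩

/-- suppose `1 ≤ s ≤ n-1` and `n - s = gcd(n,s) = d`, with `n = m·d`.
If permutations `X, X'` of a multiset `M` of size `n` can both reach a common string `W`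
by sequences of moves (rotations by `s`, or permutations within the final `(n-s)`-suffix),
then the cyclic sequence of `d`-blocks of `X'` (as multisets) is a rotation of that of `X`.
In particular, a single rotation by `s` of `X` has blocks that are a cyclic rotation of
the blocks of `X`. -/
theorem stmt_11 {α : Type*} (n s d m : ℕ) (hn : 0 < n) (hs1 : 1 ≤ s) (hsn : s ≤ n - 1)
    (hd : n - s = d) (hgcd : Nat.gcd n s = d) (hm : n = m * d)
    (M : Multiset α) (hM : Multiset.card M = n)
    (X X' : Fin n → α)
    (hX : Multiset.map X Finset.univ.val = M)
    (hX' : Multiset.map X' Finset.univ.val = M)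
    (hW : ∃ W : Fin n → α,
      Relation.ReflTransGen (Move s) X W ∧ Relation.ReflTransGen (Move s) X' W) :
    (∃ r : ℕ, ∀ a : ℕ, blockMS hn d X' a = blockMS hn d X (a + r)) ∧
      (∃ r : ℕ, ∀ a : ℕ, blockMS hn d (rotF s X) a = blockMS hn d X (a + r)) := by
  have hs : ∃ k, m = k + 1 ∧ s = k * d := by
    rcases m with _ | k
    · omega
    · exact ⟨k, rfl, by rw [add_mul, one_mul] at hm; omega⟩
  obtain ⟨k, rfl, rfl⟩ := hs
  obtain ⟨W, hXW, hXW'⟩ := hW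
  obtain ⟨r, hr⟩ := exists_blockMS_eq_of_reflTransGen_move hn hm hXW
  obtain ⟨r', hr'⟩ := exists_blockMS_eq_of_reflTransGen_move hn hm hXW'
  refine ⟨⟨r' * k + r, fun a => ?_⟩, k, blockMS_rotF hn d k X⟩
  have h : a % (k + 1) = (a + r' * k + r') % (k + 1) := by
    rw [show a + r' * k + r' = a + r' * (k + 1) by ring, Nat.add_mul_mod_self_right]
  rw [blockMS_congr_mod hn hm X' h, ← hr', hr, add_assoc]
end
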